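/- Let Δ > 0, let S be a finite connected edge-weighted graph with shortest-path metric d_S, and let P be a nonempty vertex subset such that every vertex u of S satisfies d_S(u,P) ≤ Δ/4. Let c ∈ P, let 0 ≤ α ≤ 1/4, and let B = {u ∈ V(S) : d_S(u,c) − d_S(u,P) ≤ αΔ}. Then every u ∈ B satisfies d_{S[B]}(u,c) ≤ Δ/2, where S[B] is the subgraph of S induced on B; in particular the strong diameter of B satisfies max_{x,y∈B} d_{S[B]}(x,y) ≤ Δ. -/

import Mathlib

open MeasureTheory Real ENNReal

namespace KPRpaper

variable {V : Type*}

/-- The total weight of a walk in an edge-weighted graph. -/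
def walkWeight (w : V → V → ℝ) {G : SimpleGraph V} {x y : V} (p : G.Walk x y) : ℝ :=
  (p.darts.map (fun d => w d.toProd.1 d.toProd.2)).sum

/-- Shortest-path distance between `x` and `y` using only walks whose vertices all
lie in the set `s` (`⊤` if there is no such walk). -/
noncomputable def dIn (G : SimpleGraph V) (w : V → V → ℝ) (s : Set V) (x y : V) : ℝ≥0∞ :=
  ⨅ p : {p : G.Walk x y // ∀ v ∈ p.support, v ∈ s}, ENNReal.ofReal (walkWeight w p.1)

/-- Shortest-path distance in the whole graph. -/
noncomputable def dG (G : SimpleGraph V) (w : V → V → ℝ) (x y : V) : ℝ≥0∞ :=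
  dIn G w Set.univ x y

/-- Distance from a point to a set, within the vertex set `s`. -/
noncomputable def dSet (G : SimpleGraph V) (w : V → V → ℝ) (s : Set V) (x : V) (A : Set V) :
    ℝ≥0∞ :=
  ⨅ a ∈ A, dIn G w s x a

/-- The ball of radius `ρ` around `z` in the shortest-path metric. -/
def gball (G : SimpleGraph V) (w : V → V → ℝ) (z : V) (ρ : ℝ) : Set V :=
  {v | dG G w z v ≤ ENNReal.ofReal ρ}

/-- The ball of radius `ρ` around the set `A`, inside the induced subgraph on `s`. -/
def gballIn (G : SimpleGraph V) (w : V → V → ℝ) (s A : Set V) (ρ : ℝ) : Set V :=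
  {v | v ∈ s ∧ dSet G w s v A ≤ ENNReal.ofReal ρ}

/-- `G` contains the complete graph `K_q` as a minor: there are `q` pairwise disjoint
nonempty vertex sets, each inducing a connected subgraph, with an edge between any two. -/
def HasCliqueMinor (G : SimpleGraph V) (q : ℕ) : Prop :=
  ∃ S : Fin q → Set V,
    (∀ i, (S i).Nonempty) ∧
    (∀ i, (G.induce (S i)).Connected) ∧
    (∀ i j, i ≠ j → Disjoint (S i) (S j)) ∧
    (∀ i j, i ≠ j → ∃ u ∈ S i, ∃ v ∈ S j, G.Adj u v)

/-- There is a walk from `x` to `y` all of whose vertices lie in `s`. -/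
def ReachableIn (G : SimpleGraph V) (s : Set V) (x y : V) : Prop :=
  ∃ p : G.Walk x y, ∀ v ∈ p.support, v ∈ s


section Walks

variable {G : SimpleGraph V} {w : V → V → ℝ}

theorem walkWeight_cons {x y z : V} (h : G.Adj x y) (p : G.Walk y z) :
    walkWeight w (SimpleGraph.Walk.cons h p) = w x y + walkWeight w p := by
  simp [walkWeight]

theorem walkWeight_append {x y z : V} (p : G.Walk x y) (q : G.Walk y z) :
    walkWeight w (p.append q) = walkWeight w p + walkWeight w q := by
  simp [walkWeight]

theorem walkWeight_reverse (hws : ∀ u v, w u v = w v u) {x y : V} (p : G.Walk x y) :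
    walkWeight w p.reverse = walkWeight w p := by
  have h : ((fun d : G.Dart => w d.toProd.1 d.toProd.2) ∘ SimpleGraph.Dart.symm) =
      fun d => w d.toProd.1 d.toProd.2 := by
    funext d
    exact hws _ _
  simp [walkWeight, SimpleGraph.Walk.darts_reverse, List.sum_reverse, h]

theorem walkWeight_nonneg (hw : ∀ u v, G.Adj u v → 0 < w u v) {x y : V} (p : G.Walk x y) :
    0 ≤ walkWeight w p := by
  refine List.sum_nonneg fun r hr => ?_
  obtain ⟨d, -, rfl⟩ := List.mem_map.1 hr
  exact (hw _ _ d.adj).le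

theorem walkWeight_bypass_le [DecidableEq V] (hw : ∀ u v, G.Adj u v → 0 < w u v) {x y : V}
    (p : G.Walk x y) : walkWeight w p.bypass ≤ walkWeight w p := by
  refine (p.darts_bypass_sublist_darts.map _).sum_le_sum fun r hr => ?_
  obtain ⟨d, -, rfl⟩ := List.mem_map.1 hr
  exact (hw _ _ d.adj).le

theorem dIn_le_walkWeight {s : Set V} {x y : V} (p : G.Walk x y) (hp : ∀ v ∈ p.support, v ∈ s) :
    dIn G w s x y ≤ ENNReal.ofReal (walkWeight w p) :=
  iInf_le (fun p : {p : G.Walk x y // ∀ v ∈ p.support, v ∈ s} =>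
    ENNReal.ofReal (walkWeight w p.1)) ⟨p, hp⟩

theorem dG_le_walkWeight {x y : V} (p : G.Walk x y) :
    dG G w x y ≤ ENNReal.ofReal (walkWeight w p) :=
  dIn_le_walkWeight p fun _ _ => Set.mem_univ _

/-- In a finite connected graph with positive weights, the distance is attained by a walk. -/
theorem exists_walkWeight_le_dG [Finite V] (hw : ∀ u v, G.Adj u v → 0 < w u v)
    (hconn : G.Connected) (x y : V) :
    ∃ p : G.Walk x y, ENNReal.ofReal (walkWeight w p) ≤ dG G w x y := by
  classical
  have := Fintype.ofFinite V
  have : Nonempty (G.Path x y) := Nonempty.map SimpleGraph.Walk.toPath (hconn x y)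
  obtain ⟨p, hp⟩ := Finite.exists_min fun p : G.Path x y => walkWeight w p.1
  refine ⟨p.1, le_iInf fun q => ENNReal.ofReal_le_ofReal ?_⟩
  exact (hp q.1.toPath).trans (walkWeight_bypass_le hw q.1)

theorem dSet_univ_le_add {x y : V} (hw : ∀ u v, G.Adj u v → 0 < w u v) (h : G.Adj x y)
    (A : Set V) :
    dSet G w Set.univ x A ≤ ENNReal.ofReal (w x y) + dSet G w Set.univ y A := by
  simp only [dSet, dIn, ENNReal.add_iInf]
  refine le_iInf₂ fun a ha => le_iInf fun p => ?_
  refine (iInf₂_le a ha).trans ((dIn_le_walkWeight (.cons h p.1) fun _ _ => Set.mem_univ _).trans ?_)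
  rw [walkWeight_cons, ENNReal.ofReal_add (hw _ _ h).le (walkWeight_nonneg hw _)]

/-- Cones around `c` contain the walks to `c` whose weight witnesses membership. -/
theorem dG_le_dSet_add_of_mem_support (hw : ∀ u v, G.Adj u v → 0 < w u v) (A : Set V) (K : ℝ≥0∞)
    {u c : V} (p : G.Walk u c)
    (hp : ENNReal.ofReal (walkWeight w p) ≤ dSet G w Set.univ u A + K) :
    ∀ v ∈ p.support, dG G w v c ≤ dSet G w Set.univ v A + K := by
  induction p with
  | nil =>
    intro v hv
    rw [SimpleGraph.Walk.mem_support_nil_iff] at hv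
    subst hv
    exact (dG_le_walkWeight _).trans hp
  | @cons x y z h p ih =>
    intro v hv
    rw [SimpleGraph.Walk.support_cons, List.mem_cons] at hv
    rcases hv with rfl | hv
    · exact (dG_le_walkWeight _).trans hp
    · refine ih ?_ v hv
      rw [walkWeight_cons, ENNReal.ofReal_add (hw _ _ h).le (walkWeight_nonneg hw _)] at hp
      have hle := hp.trans (add_le_add_left (dSet_univ_le_add hw h A) K)
      rw [add_assoc] at hle
      exact (ENNReal.add_le_add_iff_left ENNReal.ofReal_ne_top).1 hle

end Walks

/-- Lemma 5.2 / `lem:strong`.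
Let `Δ > 0`, let `S` be a finite connected edge-weighted graph in which every vertex is
within distance `Δ/4` of the nonempty vertex set `P`, let `c ∈ P`, `0 ≤ α ≤ 1/4`, and
let `B = {u | d_S(u,c) - d_S(u,P) ≤ αΔ}` (expressed subtraction-free).  Then every
`u ∈ B` satisfies `d_{S[B]}(u,c) ≤ Δ/2`, and the strong diameter of `B` is at most
`Δ`. -/
theorem cone_strong_diameter
    {V : Type} [Fintype V] (S : SimpleGraph V) (w : V → V → ℝ)
    (hw : ∀ u v, S.Adj u v → 0 < w u v) (hws : ∀ u v, w u v = w v u)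
    (hconn : S.Connected) (Δ : ℝ) (hΔ : 0 < Δ)
    (P : Set V) (hP : P.Nonempty)
    (hnear : ∀ u : V, dSet S w Set.univ u P ≤ ENNReal.ofReal (Δ / 4))
    (c : V) (hc : c ∈ P) (α : ℝ) (hα0 : 0 ≤ α) (hα : α ≤ 1/4)
    (B : Set V)
    (hB : B = {u | dG S w u c ≤ dSet S w Set.univ u P + ENNReal.ofReal (α * Δ)}) :
    (∀ u ∈ B, dIn S w B u c ≤ ENNReal.ofReal (Δ / 2)) ∧
    (∀ x ∈ B, ∀ y ∈ B, dIn S w B x y ≤ ENNReal.ofReal Δ) := by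
  have key : ∀ u ∈ B, ∃ p : S.Walk u c, (∀ v ∈ p.support, v ∈ B) ∧ walkWeight w p ≤ Δ / 2 := by
    intro u hu
    obtain ⟨p, hp⟩ := exists_walkWeight_le_dG hw hconn u c
    rw [hB] at hu ⊢
    have hpu := hp.trans hu
    refine ⟨p, dG_le_dSet_add_of_mem_support hw P _ p hpu, ?_⟩
    have h := hpu.trans (add_le_add_left (hnear u) _)
    rw [← ENNReal.ofReal_add (by positivity) (by positivity),
      ENNReal.ofReal_le_ofReal_iff (by positivity)] at h
    nlinarith
  refine ⟨fun u hu => ?_, fun x hx y hy => ?_⟩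
  · obtain ⟨p, hpB, hp⟩ := key u hu
    exact (dIn_le_walkWeight p hpB).trans (ENNReal.ofReal_le_ofReal hp)
  · obtain ⟨p, hpB, hp⟩ := key x hx
    obtain ⟨q, hqB, hq⟩ := key y hy
    refine (dIn_le_walkWeight (p.append q.reverse) fun v hv => ?_).trans
      (ENNReal.ofReal_le_ofReal ?_)
    · rw [SimpleGraph.Walk.mem_support_append_iff, SimpleGraph.Walk.support_reverse,
        List.mem_reverse] at hv
      exact hv.elim (hpB v) (hqB v)
    · rw [walkWeight_append, walkWeight_reverse hws]
      linarith

end KPRpaper
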